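/- Let V ∈ ℂ[q₁,…,q_n] be homogeneous of degree k > 2 (n ≥ 2) such that the set 𝓓 = {d ∈ ℂⁿ \ {0} : V'(d) = d} has exactly (k−1)ⁿ − 1 elements and the Kovalevskaya matrix V''(d) − E is nonsingular at each d ∈ 𝓓. Then for every 0 ≤ r ≤ n−1, Σ_{d ∈ 𝓓} τ_r(Λ(d)) / τ_{n−1}(Λ(d)) = (k−2)·(−1)^{r+1−n}·Σ_{i=0}^{r} C(n−i−1, r−i)·(k−1)^{i}, where Λ(d) is the multiset of nontrivial Kovalevskaya exponents at d. (Equivalently, the sum over the D(n,k−1) Darboux points in projective space equals (−1)^{r+1−n}·Σ_{i=0}^{r} C(n−i−1, r−i)·(k−1)^{i}.) -/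

import Mathlib

open MvPolynomial

/-- Polynomials all of whose monomials have degree `< d`. -/
noncomputable def Fil (n d : ℕ) : Submodule ℂ (MvPolynomial (Fin n) ℂ) :=
  restrictSupport ℂ {a | a.degree < d}

lemma mem_Fil {n d : ℕ} {p : MvPolynomial (Fin n) ℂ} :
    p ∈ Fil n d ↔ ∀ a ∈ p.support, a.degree < d := by
  unfold Fil
  rw [mem_restrictSupport_iff]
  rfl

lemma Fil_mono {n d e : ℕ} (h : d ≤ e) : Fil n d ≤ Fil n e := by
  intro p hp
  rw [mem_Fil] at *
  intro a ha
  exact (hp a ha).trans_le h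

lemma monomial_mem_Fil {n d : ℕ} {a : Fin n →₀ ℕ} (c : ℂ) (h : a.degree < d) :
    monomial a c ∈ Fil n d := by
  unfold Fil
  rw [monomial_mem_restrictSupport]
  exact Or.inl h

lemma mul_mem_Fil {n d e : ℕ} {p q : MvPolynomial (Fin n) ℂ} (hp : p ∈ Fil n (d + 1))
    (hq : q ∈ Fil n e) : p * q ∈ Fil n (d + e) := by
  classical
  rw [mem_Fil] at *
  intro a ha
  obtain ⟨b, hb, c, hc, rfl⟩ := Finset.mem_add.mp (support_mul p q ha)
  have := hp b hb
  have := hq c hc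
  rw [map_add]
  omega

lemma mul_mem_Fil' {n d e : ℕ} {p q : MvPolynomial (Fin n) ℂ} (hp : p ∈ Fil n d)
    (hq : q ∈ Fil n (e + 1)) : p * q ∈ Fil n (d + e) := by
  rw [mul_comm, add_comm]; exact mul_mem_Fil hq hp

lemma one_mem_Fil {n : ℕ} : (1 : MvPolynomial (Fin n) ℂ) ∈ Fil n 1 := by
  have := monomial_mem_Fil (n := n) (d := 1) (a := 0) 1 (by simp)
  simpa using this

lemma prod_mem_Fil {n e : ℕ} {ι : Type*} (s : Finset ι) (f : ι → MvPolynomial (Fin n) ℂ)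
    (hf : ∀ i ∈ s, f i ∈ Fil n (e + 1)) : ∏ i ∈ s, f i ∈ Fil n (s.card * e + 1) := by
  classical
  induction s using Finset.induction_on with
  | empty => simpa using one_mem_Fil
  | insert a s ha ih =>
    rw [Finset.prod_insert ha, Finset.card_insert_of_notMem ha]
    have h1 := hf a (Finset.mem_insert_self _ _)
    have h2 := ih (fun i hi => hf i (Finset.mem_insert_of_mem hi))
    have := mul_mem_Fil h1 h2
    convert this using 2
    ring

lemma prod_sub_mem_Fil {n e : ℕ} {ι : Type*} (s : Finset ι) (f g : ι → MvPolynomial (Fin n) ℂ)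
    (hf : ∀ i ∈ s, f i ∈ Fil n (e + 1)) (hg : ∀ i ∈ s, g i ∈ Fil n (e + 1))
    (hfg : ∀ i ∈ s, f i - g i ∈ Fil n e) :
    ∏ i ∈ s, f i - ∏ i ∈ s, g i ∈ Fil n (s.card * e) := by
  classical
  induction s using Finset.induction_on with
  | empty => simp
  | insert a s ha ih =>
    rw [Finset.prod_insert ha, Finset.prod_insert ha, Finset.card_insert_of_notMem ha]
    have h1 := hf a (Finset.mem_insert_self _ _)
    have h2 := ih (fun i hi => hf i (Finset.mem_insert_of_mem hi))
      (fun i hi => hg i (Finset.mem_insert_of_mem hi))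
      (fun i hi => hfg i (Finset.mem_insert_of_mem hi))
    have h3 := prod_mem_Fil s g (fun i hi => hg i (Finset.mem_insert_of_mem hi))
    have h4 := mul_mem_Fil h1 h2
    have h5 := mul_mem_Fil' (hfg a (Finset.mem_insert_self _ _)) h3
    have h6 : (s.card + 1) * e = e + s.card * e := by ring
    rw [h6]
    have := (Fil n _).add_mem h4 h5
    convert this using 1
    ring

lemma det_sub_mem_Fil {n e : ℕ} (A B : Matrix (Fin n) (Fin n) (MvPolynomial (Fin n) ℂ))
    (hA : ∀ i j, A i j ∈ Fil n (e + 1)) (hB : ∀ i j, B i j ∈ Fil n (e + 1))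
    (hAB : ∀ i j, A i j - B i j ∈ Fil n e) :
    A.det - B.det ∈ Fil n (n * e) := by
  rw [Matrix.det_apply, Matrix.det_apply, ← Finset.sum_sub_distrib]
  refine Submodule.sum_mem _ fun σ _ => ?_
  rw [← smul_sub]
  have h := prod_sub_mem_Fil (e := e) Finset.univ (fun i => A (σ i) i) (fun i => B (σ i) i)
    (fun i _ => hA _ _) (fun i _ => hB _ _) (fun i _ => hAB _ _)
  rw [Finset.card_univ, Fintype.card_fin] at h
  rcases Int.units_eq_one_or (Equiv.Perm.sign σ) with h' | h' <;> rw [h']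
  · simpa using h
  · rw [Units.neg_smul, one_smul]
    exact (Fil n _).neg_mem h

/-- Existence of Bezout decompositions with degree control. -/
def HasBez (n d : ℕ) (p : MvPolynomial (Fin n) ℂ) : Prop :=
  ∃ b : (Fin n → ℂ) → Fin n → MvPolynomial (Fin n) ℂ,
    (∀ w, C (eval w p) - p = ∑ j, b w j * (C (w j) - X j)) ∧
    (∀ w j, b w j ∈ Fil n d) ∧ ∀ w w' j, b w j - b w' j ∈ Fil n (d - 1)

lemma HasBez.zero (n d : ℕ) : HasBez n d 0 :=
  ⟨fun _ _ => 0, by simp, by simp, by simp⟩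

lemma HasBez.mono {n d e : ℕ} {p : MvPolynomial (Fin n) ℂ} (h : HasBez n d p) (hde : d ≤ e) :
    HasBez n e p := by
  obtain ⟨b, h1, h2, h3⟩ := h
  exact ⟨b, h1, fun w j => Fil_mono hde (h2 w j), fun w w' j => Fil_mono (by omega) (h3 w w' j)⟩

lemma HasBez.add {n d : ℕ} {p q : MvPolynomial (Fin n) ℂ} (h : HasBez n d p) (h' : HasBez n d q) :
    HasBez n d (p + q) := by
  obtain ⟨b, h1, h2, h3⟩ := h
  obtain ⟨b', h1', h2', h3'⟩ := h'
  refine ⟨fun w j => b w j + b' w j, fun w => ?_, fun w j => (Fil n _).add_mem (h2 _ _) (h2' _ _),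
    fun w w' j => ?_⟩
  · simp only [add_mul, Finset.sum_add_distrib, ← h1, ← h1', map_add]
    ring
  · have := (Fil n _).add_mem (h3 w w' j) (h3' w w' j)
    convert this using 1
    ring

lemma HasBez.smul {n d : ℕ} {p : MvPolynomial (Fin n) ℂ} (c : ℂ) (h : HasBez n d p) :
    HasBez n d (c • p) := by
  obtain ⟨b, h1, h2, h3⟩ := h
  refine ⟨fun w j => c • b w j, fun w => ?_, fun w j => (Fil n _).smul_mem _ (h2 _ _),
    fun w w' j => ?_⟩
  · simp only [smul_mul_assoc, ← Finset.smul_sum, ← h1]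
    rw [smul_sub]
    congr 1
    simp [smul_eq_C_mul]
  · have := (Fil n _).smul_mem c (h3 w w' j)
    rwa [smul_sub] at this

lemma HasBez.X_mul {n d : ℕ} {p : MvPolynomial (Fin n) ℂ} (i : Fin n) (hp : p ∈ Fil n (d + 1))
    (h : HasBez n d p) : HasBez n (d + 1) (X i * p) := by
  classical
  obtain ⟨b, h1, h2, h3⟩ := h
  refine ⟨fun w j => w i • b w j + if j = i then p else 0, fun w => ?_, fun w j => ?_,
    fun w w' j => ?_⟩
  · simp only [add_mul, smul_mul_assoc, Finset.sum_add_distrib, ← Finset.smul_sum, ← h1, ite_mul,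
      zero_mul, Finset.sum_ite_eq', Finset.mem_univ, if_true]
    simp only [smul_eq_C_mul, map_mul, eval_X]
    ring
  · refine (Fil n _).add_mem ((Fil n _).smul_mem _ (Fil_mono (by omega) (h2 w j))) ?_
    split_ifs
    · exact hp
    · exact (Fil n _).zero_mem
  · rw [add_sub_add_right_eq_sub]
    exact (Fil n _).sub_mem ((Fil n _).smul_mem _ (h2 w j)) ((Fil n _).smul_mem _ (h2 w' j))

lemma hasBez_monomial {n : ℕ} (d : ℕ) : ∀ (a : Fin n →₀ ℕ), a.degree = d →
    HasBez n d (monomial a (1 : ℂ)) := by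
  induction d with
  | zero =>
    intro a ha
    have : a = 0 := (Finsupp.degree_eq_zero_iff a).mp ha
    subst this
    exact ⟨fun _ _ => 0, by simp, by simp, by simp⟩
  | succ d ih =>
    intro a ha
    have hne : a ≠ 0 := by rintro rfl; simp at ha
    obtain ⟨i, hi⟩ := Finsupp.ne_iff.mp hne
    have hi' : Finsupp.single i 1 ≤ a := by
      rw [Finsupp.single_le_iff]
      simp at hi; omega
    obtain ⟨b, rfl⟩ := le_iff_exists_add.mp hi'
    have hb : b.degree = d := by
      rw [map_add, Finsupp.degree_single] at ha
      omega
    have := (ih b hb).X_mul i (monomial_mem_Fil 1 (by omega))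
    simpa [X, monomial_mul] using this

lemma hasBez {n d : ℕ} {p : MvPolynomial (Fin n) ℂ} (hp : p ∈ Fil n (d + 1)) :
    HasBez n d p := by
  classical
  rw [p.as_sum]
  rw [mem_Fil] at hp
  refine Finset.sum_induction _ (HasBez n d) (fun _ _ => HasBez.add) (HasBez.zero n d) ?_
  intro a ha
  have h := ((hasBez_monomial _ a rfl).mono (Nat.lt_succ_iff.mp (hp a ha))).smul (p.coeff a)
  rwa [smul_monomial, smul_eq_mul, mul_one] at h

/-- Evaluating the Bezout coefficient on the diagonal gives the partial derivative. -/
lemma bez_diag {n : ℕ} {p : MvPolynomial (Fin n) ℂ} {w : Fin n → ℂ}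
    {b : Fin n → MvPolynomial (Fin n) ℂ} (h : C (eval w p) - p = ∑ j, b j * (C (w j) - X j))
    (i : Fin n) : eval w (b i) = eval w (pderiv i p) := by
  classical
  have := congrArg (fun q => eval w (pderiv i q)) h
  simp only [map_sub, pderiv_C, zero_sub, map_sum, Derivation.leibniz, map_add, smul_eq_mul,
    map_mul, eval_C, eval_X, sub_self, zero_mul, add_zero, pderiv_X, map_neg] at this
  simp [Pi.single_apply, apply_ite] at this
  simpa using this.symm

/-- The reduction operator: divides monomials with some exponent `≥ m`. -/
noncomputable def redT {n : ℕ} (m : ℕ) (F : Fin n → MvPolynomial (Fin n) ℂ) :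
    MvPolynomial (Fin n) ℂ →ₗ[ℂ] MvPolynomial (Fin n) ℂ :=
  open Classical in
  (basisMonomials (Fin n) ℂ).constr ℂ (fun a =>
    if h : ∃ i, m ≤ a i then monomial (a - Finsupp.single h.choose m) 1 * F h.choose else 0)

lemma redT_box {n m : ℕ} (F : Fin n → MvPolynomial (Fin n) ℂ) (a : Fin n →₀ ℕ)
    (h : ∀ i, a i < m) : redT m F (monomial a 1) = 0 := by
  classical
  have := (basisMonomials (Fin n) ℂ).constr_basis ℂ (fun a =>
    if h : ∃ i, m ≤ a i then monomial (a - Finsupp.single h.choose m) 1 * F h.choose else 0) a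
  rw [coe_basisMonomials] at this
  unfold redT
  rw [dif_neg (by push Not; exact h)] at this
  exact this

lemma redT_nonbox {n m : ℕ} (F : Fin n → MvPolynomial (Fin n) ℂ) (a : Fin n →₀ ℕ)
    (h : ∃ i, m ≤ a i) : ∃ (i : Fin n) (b : Fin n →₀ ℕ), a = b + Finsupp.single i m ∧
      redT m F (monomial a 1) = monomial b 1 * F i := by
  classical
  have := (basisMonomials (Fin n) ℂ).constr_basis ℂ (fun a =>
    if h : ∃ i, m ≤ a i then monomial (a - Finsupp.single h.choose m) 1 * F h.choose else 0) a
  rw [coe_basisMonomials] at this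
  rw [dif_pos h] at this
  refine ⟨h.choose, a - Finsupp.single h.choose m, ?_, this⟩
  rw [tsub_add_cancel_of_le]
  rw [Finsupp.single_le_iff]
  exact h.choose_spec

lemma Fil_eq_span (n d : ℕ) :
    Fil n d = Submodule.span ℂ ((fun a => monomial a (1 : ℂ)) '' {a | a.degree < d}) :=
  restrictSupport_eq_span _ _

lemma redT_mem {n m d : ℕ} (F : Fin n → MvPolynomial (Fin n) ℂ) (hF : ∀ i, F i ∈ Fil n (m + 1))
    : ∀ h ∈ Fil n d, redT m F h ∈ Fil n d := by
  suffices Fil n d ≤ (Fil n d).comap (redT m F) from this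
  conv_lhs => rw [Fil_eq_span]
  rw [Submodule.span_le]
  rintro _ ⟨a, ha, rfl⟩
  simp only [Set.mem_ofPred_eq] at ha
  simp only [SetLike.mem_coe, Submodule.mem_comap]
  by_cases h : ∃ i, m ≤ a i
  · obtain ⟨i, b, hab, hb⟩ := redT_nonbox F a h
    rw [hb]
    have h1 : (monomial b (1 : ℂ)) ∈ Fil n (b.degree + 1) := monomial_mem_Fil 1 (by omega)
    have h2 := mul_mem_Fil h1 (hF i)
    refine Fil_mono ?_ h2
    rw [hab, map_add, Finsupp.degree_single] at ha
    omega
  · push Not at h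
    rw [redT_box F a h]
    exact (Fil n d).zero_mem

instance Fil_finite (n d : ℕ) : FiniteDimensional ℂ (Fil n d) := by
  rw [Fil_eq_span]
  refine FiniteDimensional.span_of_finite ℂ (Set.Finite.image _ ?_)
  refine Set.Finite.subset (Set.finite_Iic (Finsupp.equivFunOnFinite.symm (fun _ : Fin n => d))) ?_
  intro a ha i
  have : a i ≤ a.degree := Finsupp.le_degree i a
  simp only [Set.mem_ofPred_eq] at ha
  simp only [Finsupp.equivFunOnFinite_symm_apply_apply]
  omega

lemma redT_surj {n m : ℕ} (d : ℕ) (F : Fin n → MvPolynomial (Fin n) ℂ)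
    (hF : ∀ i, F i ∈ Fil n (m + 1)) : ∃ S : Set ℂ, S.Finite ∧ ∀ ε ∉ S, ∀ g ∈ Fil n d,
      ∃ h ∈ Fil n d, redT m F h + ε • h = g := by
  let T : Module.End ℂ (Fil n d) := (redT m F).restrict (redT_mem F hF)
  refine ⟨Neg.neg '' {μ | T.HasEigenvalue μ}, T.finite_hasEigenvalue.image _, ?_⟩
  intro ε hε g hg
  have h1 : ¬ T.HasEigenvalue (-ε) := fun h => hε ⟨-ε, h, neg_neg _⟩
  rw [Module.End.hasEigenvalue_iff_mem_spectrum, spectrum.notMem_iff] at h1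
  obtain ⟨h, hh⟩ := ((Module.End.isUnit_iff _).mp h1).2 ⟨-g, (Fil n d).neg_mem hg⟩
  refine ⟨h, h.2, ?_⟩
  have := congrArg Subtype.val hh
  simp [T, Module.algebraMap_end_apply] at this
  rw [← neg_eq_iff_eq_neg] at this
  rw [← this]
  abel

lemma box_span {n e : ℕ} (F : Fin n → MvPolynomial (Fin n) ℂ) (ε : ℂ)
    {ι : Type*} [Fintype ι] (z : ι → Fin n → ℂ)
    (hz : ∀ s i, eval (z s) (F i + C ε * X i ^ (e + 1)) = 0) :
    ∃ (W : Submodule ℂ (ι → ℂ)), Module.finrank ℂ W ≤ (e + 1) ^ n - 1 ∧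
      ∀ h ∈ Fil n (n * e), (fun s => eval (z s) (redT (e + 1) F h + ε • h)) ∈ W := by
  classical
  let ev : MvPolynomial (Fin n) ℂ →ₗ[ℂ] (ι → ℂ) :=
    LinearMap.pi fun s => (aeval (z s)).toLinearMap
  have hev : ∀ p s, ev p s = eval (z s) p := by
    intro p s
    simp [ev, aeval_eq_eval]
  let top : Fin n → Fin (e + 1) := fun _ => Fin.last e
  let v : {a : Fin n → Fin (e + 1) // a ≠ top} → ι → ℂ := fun a =>
    ev (monomial (Finsupp.equivFunOnFinite.symm (fun i => (a.1 i : ℕ))) 1)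
  refine ⟨Submodule.span ℂ (Set.range v), ?_, ?_⟩
  · refine (finrank_range_le_card v).trans (le_of_eq ?_)
    rw [Fintype.card_subtype_compl]
    simp
  let L : MvPolynomial (Fin n) ℂ →ₗ[ℂ] (ι → ℂ) := ev ∘ₗ (redT (e + 1) F + ε • LinearMap.id)
  have hL : ∀ h, (fun s => eval (z s) (redT (e + 1) F h + ε • h)) = L h := by
    intro h
    funext s
    simp only [L, LinearMap.comp_apply, hev]
    rfl
  simp only [hL]
  suffices Fil n (n * e) ≤ (Submodule.span ℂ (Set.range v)).comap L from this
  rw [Fil_eq_span, Submodule.span_le]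
  rintro _ ⟨a, ha, rfl⟩
  simp only [Set.mem_ofPred_eq] at ha
  simp only [SetLike.mem_coe, Submodule.mem_comap, L, LinearMap.comp_apply, LinearMap.add_apply,
    LinearMap.smul_apply, LinearMap.id_apply]
  by_cases h : ∃ i, e + 1 ≤ a i
  · obtain ⟨i, b, hab, hb⟩ := redT_nonbox F a h
    rw [hb]
    have h0 : ε • (monomial a (1 : ℂ)) = monomial b 1 * (C ε * X i ^ (e + 1)) := by
      rw [hab, X_pow_eq_monomial, C_mul_monomial, monomial_mul, smul_monomial]
      simp
    rw [h0, ← mul_add]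
    convert Submodule.zero_mem _
    funext s
    rw [hev, map_mul, hz s i, mul_zero]
    rfl
  · push Not at h
    rw [redT_box F a h, zero_add, map_smul]
    refine Submodule.smul_mem _ _ (Submodule.subset_span ?_)
    refine ⟨⟨fun i => ⟨a i, h i⟩, ?_⟩, ?_⟩
    · intro htop
      have : ∀ i, a i = e := fun i => by
        have := congrArg Fin.val (congrFun htop i)
        simpa [top] using this
      rw [Finsupp.degree_eq_sum] at ha
      simp [this] at ha
    · simp only [v]
      congr 2
      ext i
      simp

/-- Euler-Jacobi for a system without zeros at infinity. -/
lemma EJ_nice {n e : ℕ} (F : Fin n → MvPolynomial (Fin n) ℂ)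
    (hF : ∀ i, F i ∈ Fil n (e + 2)) (ε : ℂ)
    (hε : ∀ g ∈ Fil n (n * e), ∃ h ∈ Fil n (n * e), redT (e + 1) F h + ε • h = g)
    {ι : Type*} [Fintype ι] (hcard : Fintype.card ι = (e + 1) ^ n) (z : ι → Fin n → ℂ)
    (hinj : Function.Injective z)
    (hz : ∀ s i, eval (z s) (F i + C ε * X i ^ (e + 1)) = 0)
    (hJ : ∀ s, (Matrix.of fun i j =>
      eval (z s) (pderiv j (F i + C ε * X i ^ (e + 1)))).det ≠ 0) :
    ∀ g ∈ Fil n (n * e), ∑ s, eval (z s) g / (Matrix.of fun i j =>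
      eval (z s) (pderiv j (F i + C ε * X i ^ (e + 1)))).det = 0 := by
  classical
  obtain ⟨W, hW, hWmem⟩ := box_span F ε z hz
  have hWtop : W < ⊤ := by
    rw [lt_top_iff_ne_top]
    rintro rfl
    rw [finrank_top, Module.finrank_fintype_fun_eq_card, hcard] at hW
    have : 0 < (e + 1) ^ n := by positivity
    omega
  obtain ⟨f, hf0, hfW⟩ := Submodule.exists_le_ker_of_lt_top W hWtop
  have hfsum : ∀ v : ι → ℂ, f v = ∑ s, v s * f (Pi.single s 1) := by
    intro v
    rw [LinearMap.pi_apply_eq_sum_univ f v]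
    refine Finset.sum_congr rfl fun s _ => ?_
    rw [smul_eq_mul]
    congr 2
    funext t
    simp [Pi.single_apply, eq_comm]
  have hfg : ∀ g ∈ Fil n (n * e), f (fun s => eval (z s) g) = 0 := by
    intro g hg
    obtain ⟨h, hh, rfl⟩ := hε g hg
    exact hfW (hWmem h hh)
  set G : Fin n → MvPolynomial (Fin n) ℂ := fun i => F i + C ε * X i ^ (e + 1) with hG
  have hGF : ∀ i, G i ∈ Fil n (e + 1 + 1) := by
    intro i
    refine (Fil n _).add_mem (hF i) ?_
    rw [X_pow_eq_monomial, C_mul_monomial]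
    exact monomial_mem_Fil _ (by rw [Finsupp.degree_single]; omega)
  choose b hb1 hb2 hb3 using fun i => hasBez (hGF i)
  let B : ι → MvPolynomial (Fin n) ℂ := fun s => (Matrix.of fun i j => b i (z s) j).det
  let J : ι → ℂ := fun s => (Matrix.of fun i j => eval (z s) (pderiv j (G i))).det
  have hBev : ∀ s t, eval (z t) (B s) = (Matrix.of fun i j => eval (z t) (b i (z s) j)).det := by
    intro s t
    simp only [B, RingHom.map_det]
    rfl
  have hBdiag : ∀ s, eval (z s) (B s) = J s := by
    intro s
    rw [hBev]
    simp only [J]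
    congr 2
    funext i j
    exact bez_diag (hb1 i (z s)) j
  have hBoff : ∀ s t, t ≠ s → eval (z t) (B s) = 0 := by
    intro s t hts
    rw [hBev, ← Matrix.exists_mulVec_eq_zero_iff]
    refine ⟨z s - z t, sub_ne_zero.mpr (hinj.ne hts.symm), ?_⟩
    funext i
    have := congrArg (eval (z t)) (hb1 i (z s))
    simp only [map_sub, eval_C, map_sum, map_mul, eval_X] at this
    simp only [G] at this
    rw [hz, hz] at this
    simp only [Matrix.mulVec, dotProduct, Matrix.of_apply, Pi.sub_apply, Pi.zero_apply]
    rw [← this, sub_zero]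
  have hBsub : ∀ s t, B s - B t ∈ Fil n (n * e) := fun s t =>
    det_sub_mem_Fil _ _ (fun i j => hb2 _ _ _) (fun i j => hb2 _ _ _) (fun i j => hb3 _ _ _ _)
  have hfB : ∀ s, f (fun t => eval (z t) (B s)) = J s * f (Pi.single s 1) := by
    intro s
    rw [hfsum, Finset.sum_eq_single s, hBdiag]
    · intro t _ hts
      rw [hBoff s t hts, zero_mul]
    · simp
  have hconst : ∀ s t, J s * f (Pi.single s 1) = J t * f (Pi.single t 1) := by
    intro s t
    rw [← hfB, ← hfB, ← sub_eq_zero, ← map_sub]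
    have := hfg _ (hBsub s t)
    simp only [map_sub] at this
    exact this
  have hne : ∃ s, f (Pi.single s 1) ≠ 0 := by
    by_contra! hcon
    apply hf0
    ext s
    simpa using hcon s
  obtain ⟨s₀, hs₀⟩ := hne
  have hJ' : ∀ s, J s ≠ 0 := hJ
  obtain ⟨c, hc, hcJ⟩ : ∃ c : ℂ, c ≠ 0 ∧ ∀ s, J s * f (Pi.single s 1) = c :=
    ⟨_, mul_ne_zero (hJ' s₀) hs₀, fun s => hconst s s₀⟩
  intro g hg
  have h1 := hfg g hg
  rw [hfsum] at h1
  have h2 : ∀ s, f (Pi.single s 1) = c * (J s)⁻¹ := by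
    intro s
    rw [← hcJ s]
    field_simp [hJ' s]
  have h3 : ∑ s, eval (z s) g * f (Pi.single s 1) = c * ∑ s, eval (z s) g / J s := by
    rw [Finset.mul_sum]
    refine Finset.sum_congr rfl fun s _ => ?_
    rw [h2]
    ring
  rw [h3] at h1
  exact (mul_eq_zero.mp h1).resolve_left hc

lemma mv_hasStrictFDerivAt {n : ℕ} (p : MvPolynomial (Fin n) ℂ) (x : Fin n → ℂ) :
    ∃ L : (Fin n → ℂ) →L[ℂ] ℂ, HasStrictFDerivAt (fun q : Fin n → ℂ => eval q p) L x ∧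
      ∀ v, L v = ∑ i, eval x (pderiv i p) * v i := by
  classical
  induction p using MvPolynomial.induction_on with
  | C a =>
    refine ⟨0, ?_, by simp⟩
    simp only [eval_C]
    exact hasStrictFDerivAt_const a x
  | add p q hp hq =>
    obtain ⟨L, h1, h2⟩ := hp
    obtain ⟨L', h1', h2'⟩ := hq
    refine ⟨L + L', ?_, ?_⟩
    · simp only [map_add]
      exact h1.add h1'
    · intro v
      simp [h2, h2', add_mul, Finset.sum_add_distrib]
  | mul_X p i hp =>
    obtain ⟨L, h1, h2⟩ := hp
    have h3 : HasStrictFDerivAt (fun q : Fin n → ℂ => q i)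
      (ContinuousLinearMap.proj i : (Fin n → ℂ) →L[ℂ] ℂ) x :=
      (ContinuousLinearMap.proj i : (Fin n → ℂ) →L[ℂ] ℂ).hasStrictFDerivAt
    refine ⟨eval x p • ContinuousLinearMap.proj i + x i • L, ?_, ?_⟩
    · simp only [map_mul, eval_X]
      exact h1.mul h3
    · intro v
      simp only [Derivation.leibniz, pderiv_X, smul_eq_mul, map_add, map_mul, eval_X, add_mul,
        Finset.sum_add_distrib, Pi.single_apply, apply_ite, map_zero, mul_one,
        mul_zero, ite_mul, zero_mul]
      simp [h2, Finset.mul_sum, mul_assoc]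

open Filter Topology in
lemma exists_branch {n e : ℕ} (F : Fin n → MvPolynomial (Fin n) ℂ) (z : Fin n → ℂ)
    (hz : ∀ i, eval z (F i) = 0)
    (hJ : (Matrix.of fun i j => eval z (pderiv j (F i))).det ≠ 0) :
    ∃ ψ : ℂ → Fin n → ℂ, Tendsto ψ (𝓝 0) (𝓝 z) ∧
      ∀ᶠ ε in 𝓝 (0 : ℂ), ∀ i, eval (ψ ε) (F i + C ε * X i ^ (e + 1)) = 0 := by
  classical
  let f : ℂ × (Fin n → ℂ) → (Fin n → ℂ) := fun u i => eval u.2 (F i) + u.1 * u.2 i ^ (e + 1)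
  let A := Matrix.of fun i j => eval z (pderiv j (F i))
  have hstrict : ∃ f' : ℂ × (Fin n → ℂ) →L[ℂ] (Fin n → ℂ), HasStrictFDerivAt f f' (0, z) ∧
      ∀ v, f' (0, v) = A.mulVec v := by
    have hi : ∀ i, ∃ g : ℂ × (Fin n → ℂ) →L[ℂ] ℂ,
        HasStrictFDerivAt (fun u => f u i) g (0, z) ∧ ∀ v, g (0, v) = A.mulVec v i := by
      intro i
      obtain ⟨L, hL, hLv⟩ := mv_hasStrictFDerivAt (F i) z
      have h1 : HasStrictFDerivAt (fun u : ℂ × (Fin n → ℂ) => eval u.2 (F i))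
          (L ∘L ContinuousLinearMap.snd ℂ ℂ (Fin n → ℂ)) (0, z) :=
        HasStrictFDerivAt.comp (g := fun q : Fin n → ℂ => eval q (F i)) ((0 : ℂ), z) hL
          hasStrictFDerivAt_snd
      have h2 : HasStrictFDerivAt (fun u : ℂ × (Fin n → ℂ) => u.2 i) _ (0, z) :=
        ((ContinuousLinearMap.proj i : (Fin n → ℂ) →L[ℂ] ℂ).hasStrictFDerivAt).comp
          ((0 : ℂ), z) hasStrictFDerivAt_snd
      have h3 := h1.add ((hasStrictFDerivAt_fst (𝕜 := ℂ) (p := ((0 : ℂ), z))).mul (h2.pow (e + 1)))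
      refine ⟨_, h3, ?_⟩
      intro v
      simp [Matrix.mulVec, dotProduct, A, hLv]
    choose g hg1 hg2 using hi
    refine ⟨ContinuousLinearMap.pi g, hasStrictFDerivAt_pi'.mpr hg1, ?_⟩
    intro v
    funext i
    exact hg2 i v
  obtain ⟨f', hf', hf'v⟩ := hstrict
  have hinv : (f' ∘L .inr ℂ ℂ (Fin n → ℂ)).IsInvertible := by
    have hA : IsUnit A.det := isUnit_iff_ne_zero.mpr hJ
    refine ⟨(Matrix.toLinearEquiv' A (Matrix.invertibleOfIsUnitDet A hA)).toContinuousLinearEquiv, ?_⟩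
    ext1 v
    simp [hf'v]
    rfl
  have hf0 : f (0, z) = 0 := by
    funext i
    simp [f, hz]
  refine ⟨hf'.implicitFunctionOfProdDomain hinv, hf'.tendsto_implicitFunctionOfProdDomain hinv, ?_⟩
  filter_upwards [hf'.eventually_apply_implicitFunctionOfProdDomain hinv] with ε hε i
  rw [hf0] at hε
  have := congrFun hε i
  simpa [f] using this

open Filter Topology in
/-- Euler-Jacobi for a system with the maximal number of nondegenerate zeros. -/
lemma EJ {n e : ℕ} (F : Fin n → MvPolynomial (Fin n) ℂ)
    (hF : ∀ i, F i ∈ Fil n (e + 2))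
    (Z : Finset (Fin n → ℂ)) (hcard : Z.card = (e + 1) ^ n)
    (hz : ∀ z ∈ Z, ∀ i, eval z (F i) = 0)
    (hJ : ∀ z ∈ Z, (Matrix.of fun i j => eval z (pderiv j (F i))).det ≠ 0) :
    ∀ g ∈ Fil n (n * e), ∑ z ∈ Z, eval z g / (Matrix.of fun i j =>
      eval z (pderiv j (F i))).det = 0 := by
  classical
  intro g hg
  choose ψ hψ1 hψ2 using fun z : Z => exists_branch (e := e) F z.1 (hz z.1 z.2) (hJ z.1 z.2)
  obtain ⟨S, hS, hSsurj⟩ := redT_surj (m := e + 1) (n * e) F hF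
  have hle : 𝓝[≠] (0 : ℂ) ≤ 𝓝 0 := nhdsWithin_le_nhds
  obtain ⟨J, hJdef⟩ : ∃ J : ℂ → (Fin n → ℂ) → ℂ, ∀ ε q, J ε q = (Matrix.of fun i j =>
    eval q (pderiv j (F i + C ε * X i ^ (e + 1)))).det := ⟨_, fun _ _ => rfl⟩
  have hJcont : Continuous (fun u : ℂ × (Fin n → ℂ) => J u.1 u.2) := by
    simp only [hJdef]
    refine Continuous.matrix_det ?_
    refine continuous_matrix fun i j => ?_
    simp only [Matrix.of_apply, map_add, Derivation.leibniz, pderiv_C,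
      smul_eq_mul, map_mul, eval_C]
    have hc : ∀ p : MvPolynomial (Fin n) ℂ,
        Continuous fun u : ℂ × (Fin n → ℂ) => eval u.2 p :=
      fun p => (MvPolynomial.continuous_eval p).comp continuous_snd
    exact (hc _).add ((continuous_fst.mul (hc _)).add ((hc _).mul (hc _)))
  have hJ0 : ∀ q, J 0 q = (Matrix.of fun i j => eval q (pderiv j (F i))).det := by
    intro q
    simp [hJdef]
  have hpair : ∀ z : Z, Tendsto (fun ε => (ε, ψ z ε)) (𝓝[≠] (0 : ℂ)) (𝓝 (0, z.1)) := by
    intro z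
    rw [nhds_prod_eq]
    exact (tendsto_id.mono_left hle).prodMk ((hψ1 z).mono_left hle)
  have hJt : ∀ z : Z, Tendsto (fun ε => J ε (ψ z ε)) (𝓝[≠] (0 : ℂ)) (𝓝 (J 0 z.1)) :=
    fun z => Tendsto.comp (g := fun u : ℂ × (Fin n → ℂ) => J u.1 u.2)
      (hJcont.tendsto (0, z.1)) (hpair z)
  have hJne : ∀ z : Z, J 0 z.1 ≠ 0 := fun z => by rw [hJ0]; exact hJ z.1 z.2
  have hgt : ∀ z : Z, Tendsto (fun ε => eval (ψ z ε) g) (𝓝[≠] (0 : ℂ)) (𝓝 (eval z.1 g)) :=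
    fun z => ((MvPolynomial.continuous_eval g).tendsto z.1).comp ((hψ1 z).mono_left hle)
  have hlim : Tendsto (fun ε => ∑ z : Z, eval (ψ z ε) g / J ε (ψ z ε)) (𝓝[≠] (0 : ℂ))
      (𝓝 (∑ z : Z, eval z.1 g / J 0 z.1)) :=
    tendsto_finsetSum _ fun z _ => (hgt z).div (hJt z) (hJne z)
  have hSev : ∀ᶠ ε in 𝓝[≠] (0 : ℂ), ε ∉ S := by
    have h1 : (S \ {0}).Finite := hS.subset Set.sdiff_subset
    have h2 : ∀ᶠ ε in 𝓝 (0 : ℂ), ε ∉ S \ {0} :=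
      h1.isClosed.isOpen_compl.mem_nhds (by simp)
    filter_upwards [hle h2, self_mem_nhdsWithin] with ε h3 h4 h5
    exact h3 ⟨h5, h4⟩
  have hinj : ∀ᶠ ε in 𝓝[≠] (0 : ℂ), Function.Injective fun z : Z => ψ z ε := by
    have : ∀ᶠ ε in 𝓝[≠] (0 : ℂ), ∀ z z' : Z, z ≠ z' → ψ z ε ≠ ψ z' ε := by
      rw [eventually_all]
      intro z
      rw [eventually_all]
      intro z'
      by_cases h : z = z'
      · simp [h]
      · have := (((hψ1 z).mono_left hle).sub ((hψ1 z').mono_left hle)).eventually_ne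
          (sub_ne_zero.mpr (fun h' => h (Subtype.ext h')))
        filter_upwards [this] with ε h1 _ using sub_ne_zero.mp h1
    filter_upwards [this] with ε h1 z z' h2
    by_contra h3
    exact h1 z z' h3 h2
  have hzero : ∀ᶠ ε in 𝓝[≠] (0 : ℂ), ∑ z : Z, eval (ψ z ε) g / J ε (ψ z ε) = 0 := by
    have hev1 : ∀ᶠ ε in 𝓝[≠] (0 : ℂ), ∀ z : Z, ∀ i,
        eval (ψ z ε) (F i + C ε * X i ^ (e + 1)) = 0 := by
      rw [eventually_all]
      exact fun z => hle (hψ2 z)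
    have hev2 : ∀ᶠ ε in 𝓝[≠] (0 : ℂ), ∀ z : Z, J ε (ψ z ε) ≠ 0 := by
      rw [eventually_all]
      exact fun z => (hJt z).eventually_ne (hJne z)
    filter_upwards [hSev, hinj, hev1, hev2] with ε h1 h2 h3 h4
    simp only [hJdef] at h4 ⊢
    exact EJ_nice F hF ε (hSsurj ε h1) (by simpa using hcard) (fun z : Z => ψ z ε) h2 h3 h4 g hg
  have h0 : ∑ z : Z, eval z.1 g / J 0 z.1 = 0 :=
    tendsto_nhds_unique hlim (tendsto_const_nhds.congr' (hzero.mono fun ε h => h.symm))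
  simp only [hJ0] at h0
  rw [← h0, ← Finset.sum_coe_sort Z]

lemma homog_mem_Fil {n d : ℕ} {p : MvPolynomial (Fin n) ℂ} (hp : p.IsHomogeneous d) :
    p ∈ Fil n (d + 1) := by
  rw [mem_Fil]
  intro a ha
  have : a.degree = d := by
    rw [Finsupp.degree_eq_weight_one]
    exact hp (mem_support_iff.mp ha)
  omega

lemma homog_eval_zero {n d : ℕ} {p : MvPolynomial (Fin n) ℂ} (hp : p.IsHomogeneous d)
    (hd : d ≠ 0) : eval 0 p = 0 := by
  rw [MvPolynomial.eval_zero]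
  by_contra h
  have := hp (d := 0) (by rwa [← constantCoeff_eq])
  simp at this
  exact hd this.symm

lemma residue_sum (n e : ℕ) (he : 0 < e)
    (V : MvPolynomial (Fin n) ℂ) (hV : V.IsHomogeneous (e + 2))
    (D : Finset (Fin n → ℂ))
    (hD : ∀ d, d ∈ D ↔ d ≠ 0 ∧ ∀ i, eval d (pderiv i V) = d i)
    (hcard : D.card = (e + 1) ^ n - 1)
    (hK : ∀ d ∈ D, ((Matrix.of fun i j => eval d (pderiv i (pderiv j V))) - 1).det ≠ 0)
    (s : ℂ) :
    ∑ d ∈ D, ((Matrix.of fun i j => eval d (pderiv i (pderiv j V))) + Matrix.scalar (Fin n) s).det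
      / ((Matrix.of fun i j => eval d (pderiv i (pderiv j V))) - 1).det
      = ((e : ℂ) + 1) ^ n - (-s) ^ n := by
  classical
  obtain ⟨H, hHdef⟩ : ∃ H : (Fin n → ℂ) → Matrix (Fin n) (Fin n) ℂ, ∀ d,
    (Matrix.of fun i j => eval d (pderiv i (pderiv j V))) = H d := ⟨_, fun _ => rfl⟩
  simp only [hHdef] at hK ⊢
  have hHap : ∀ d i j, H d i j = eval d (pderiv i (pderiv j V)) := by
    intro d i j
    rw [← hHdef]
    rfl
  have h0D : (0 : Fin n → ℂ) ∉ D := fun h => ((hD 0).mp h).1 rfl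
  let F : Fin n → MvPolynomial (Fin n) ℂ := fun i => pderiv i V - X i
  have hV1 : ∀ i, (pderiv i V).IsHomogeneous (e + 1) := fun i => hV.pderiv
  have hV2 : ∀ i j, (pderiv i (pderiv j V)).IsHomogeneous e := fun i j => (hV1 j).pderiv
  have hF : ∀ i, F i ∈ Fil n (e + 2) := by
    intro i
    refine (Fil n _).sub_mem (homog_mem_Fil (hV1 i)) ?_
    exact Fil_mono (by omega) (homog_mem_Fil (isHomogeneous_X ℂ i))
  have hH0 : H 0 = 0 := by
    ext i j
    rw [hHap]
    exact homog_eval_zero (hV2 i j) he.ne'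
  have hJ : ∀ z, (Matrix.of fun i j => eval z (pderiv j (F i))).det = (H z - 1).det := by
    intro z
    rw [← Matrix.det_transpose]
    congr 1
    ext i j
    rw [Matrix.transpose_apply, Matrix.of_apply, Matrix.sub_apply, hHap, map_sub, map_sub,
      pderiv_X, Matrix.one_apply, Pi.single_apply]
    by_cases hij : i = j
    · simp [hij]
    · simp [hij, Ne.symm hij]
  have hKZ : ∀ z ∈ insert 0 D, (H z - 1).det ≠ 0 := by
    intro z hz
    rcases Finset.mem_insert.mp hz with rfl | hz
    · rw [hH0, zero_sub, Matrix.det_neg]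
      simp
    · exact hK z hz
  have hcZ : (insert 0 D).card = (e + 1) ^ n := by
    rw [Finset.card_insert_of_notMem h0D, hcard]
    have : 0 < (e + 1) ^ n := by positivity
    omega
  let Hp : Matrix (Fin n) (Fin n) (MvPolynomial (Fin n) ℂ) :=
    Matrix.of fun i j => pderiv i (pderiv j V)
  have hev : ∀ (c : ℂ) z, eval z (Hp + Matrix.scalar (Fin n) (C c)).det
      = (H z + Matrix.scalar (Fin n) c).det := by
    intro c z
    rw [RingHom.map_det]
    congr 1
    ext i j
    rw [RingHom.mapMatrix_apply, Matrix.map_apply, Matrix.add_apply, Matrix.add_apply, hHap,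
      Matrix.scalar_apply, Matrix.scalar_apply, Matrix.diagonal_apply, Matrix.diagonal_apply]
    by_cases hij : i = j
    · simp [hij, Hp]
    · simp [hij, Hp]
  have hconst : ∀ (c : ℂ) i j,
      (Matrix.scalar (Fin n) (C c) : Matrix (Fin n) (Fin n) (MvPolynomial (Fin n) ℂ)) i j
        ∈ Fil n e := by
    intro c i j
    rw [Matrix.scalar_apply, Matrix.diagonal_apply]
    split_ifs
    · exact monomial_mem_Fil c (by simpa using he)
    · exact (Fil n e).zero_mem
  have hmem : ∀ (c : ℂ) i j, (Hp + Matrix.scalar (Fin n) (C c) :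
      Matrix (Fin n) (Fin n) (MvPolynomial (Fin n) ℂ)) i j ∈ Fil n (e + 1) := fun c i j =>
    (Fil n _).add_mem (homog_mem_Fil (hV2 i j)) (Fil_mono (by omega) (hconst c i j))
  have hg := det_sub_mem_Fil (e := e) (Hp + Matrix.scalar (Fin n) (C s))
    (Hp + Matrix.scalar (Fin n) (C (-1))) (hmem _) (hmem _) (by
      intro i j
      rw [Matrix.add_apply, Matrix.add_apply, add_sub_add_left_eq_sub]
      exact (Fil n e).sub_mem (hconst _ _ _) (hconst _ _ _))
  have hEJ := EJ F hF (insert 0 D) hcZ (by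
    intro z hz i
    rcases Finset.mem_insert.mp hz with rfl | hz
    · simp only [F]
      rw [map_sub, homog_eval_zero (hV1 i) (by omega), eval_X]
      simp
    · simp [F, ((hD z).mp hz).2 i]) (by
    intro z hz
    rw [hJ]
    exact hKZ z hz) _ hg
  have hm1 : ∀ z, H z + Matrix.scalar (Fin n) (-1) = H z - 1 := by
    intro z
    rw [map_neg, map_one, sub_eq_add_neg]
  have hterm : ∀ z ∈ insert 0 D, eval z ((Hp + Matrix.scalar (Fin n) (C s)).det
      - (Hp + Matrix.scalar (Fin n) (C (-1))).det) / (Matrix.of fun i j =>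
      eval z (pderiv j (F i))).det = (H z + Matrix.scalar (Fin n) s).det / (H z - 1).det - 1 := by
    intro z hz
    rw [hJ, map_sub, hev, hev, hm1, sub_div, div_self (hKZ z hz)]
  rw [Finset.sum_congr rfl hterm, Finset.sum_sub_distrib, Finset.sum_const, hcZ, sub_eq_zero,
    Finset.sum_insert h0D, hH0] at hEJ
  have h00 : (0 + Matrix.scalar (Fin n) s).det / (0 - 1 : Matrix (Fin n) (Fin n) ℂ).det
      = (-s) ^ n := by
    rw [zero_add, zero_sub, Matrix.det_neg, Matrix.scalar_apply, Matrix.det_diagonal]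
    simp [neg_pow s n, mul_comm, div_eq_mul_inv, ← inv_pow]
  rw [h00] at hEJ
  rw [eq_sub_iff_add_eq, add_comm]
  simpa using hEJ

lemma det_add_scalar {n : ℕ} (K : Matrix (Fin n) (Fin n) ℂ) (c : ℂ) (hn : 2 ≤ n)
    (l : Fin (n - 1) → ℂ) (h : K.charpoly.roots = c ::ₘ Multiset.map l Finset.univ.val) (t : ℂ) :
    (K + Matrix.scalar (Fin n) t).det = (t + c) *
      ∑ r ∈ Finset.range n, (Multiset.map l Finset.univ.val).esymm r * t ^ (n - 1 - r) := by
  classical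
  have hsp : K.charpoly = (K.charpoly.roots.map fun a => Polynomial.X - Polynomial.C a).prod := by
    have := (IsAlgClosed.splits K.charpoly).eq_prod_roots_of_monic K.charpoly_monic
    exact this
  have h1 := Matrix.eval_charpoly K (-t)
  have h2 : (K + Matrix.scalar (Fin n) t).det = (-1) ^ n * K.charpoly.eval (-t) := by
    rw [h1]
    have : K + Matrix.scalar (Fin n) t = -(Matrix.scalar (Fin n) (-t) - K) := by
      rw [map_neg]; abel
    rw [this, Matrix.det_neg, Fintype.card_fin]
  have h3 := congrArg (Polynomial.eval t)
    (Multiset.prod_X_add_C_eq_sum_esymm (Multiset.map l Finset.univ.val))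
  have hcardm : (Multiset.map l Finset.univ.val).card = n - 1 := by simp
  rw [hcardm, Nat.sub_add_cancel (by omega), Polynomial.eval_finsetSum,
    Polynomial.eval_multiset_prod] at h3
  simp only [Polynomial.eval_mul, Polynomial.eval_C, Polynomial.eval_pow, Polynomial.eval_X,
    Multiset.map_map, Function.comp_def, Polynomial.eval_add] at h3
  rw [← h3, h2, hsp, h, Multiset.map_cons, Multiset.prod_cons, Polynomial.eval_mul,
    Polynomial.eval_multiset_prod]
  simp only [Multiset.map_map, Function.comp_def, Polynomial.eval_sub, Polynomial.eval_X,
    Polynomial.eval_C]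
  have h4 : (Multiset.map (fun x => -t - l x) Finset.univ.val).prod
      = (-1) ^ (n - 1) * (Multiset.map (fun x => t + l x) Finset.univ.val).prod := by
    change ∏ x, (-t - l x) = (-1) ^ (n - 1) * ∏ x, (t + l x)
    have : ∀ x, -t - l x = (-1) * (t + l x) := fun x => by ring
    simp only [this, Finset.prod_mul_distrib, Finset.prod_const, Finset.card_univ,
      Fintype.card_fin]
  rw [h4]
  obtain ⟨N, rfl⟩ : ∃ N, n = N + 1 := ⟨n - 1, by omega⟩
  have h5 : ((-1 : ℂ) ^ N) * (-1) ^ N = 1 := by rw [← mul_pow]; simp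
  simp only [Nat.add_sub_cancel, pow_succ]
  linear_combination (t + c) * (Multiset.map (fun x => t + l x) Finset.univ.val).prod * h5

lemma coeff_compare (n : ℕ) (hn : 2 ≤ n) (m : ℂ) (S : ℕ → ℂ)
    (h : ∀ t : ℂ, (t + (m - 1)) * ∑ r ∈ Finset.range n, S r * t ^ (n - 1 - r)
      = m ^ n - (1 - t) ^ n) (r : ℕ) (hr : r ≤ n - 1) :
    S r = (-1 : ℂ) ^ (n - 1 - r) * ∑ i ∈ Finset.range (r + 1),
      ((n - i - 1).choose (r - i) : ℂ) * m ^ i := by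
  classical
  let A : Polynomial ℂ := ∑ r ∈ Finset.range n, Polynomial.C (S r) * Polynomial.X ^ (n - 1 - r)
  let B : Polynomial ℂ := ∑ i ∈ Finset.range n,
    Polynomial.C (m ^ i) * (1 - Polynomial.X) ^ (n - 1 - i)
  have hAB : A = B := by
    have hne : (Polynomial.X + Polynomial.C (m - 1) : Polynomial ℂ) ≠ 0 :=
      Polynomial.X_add_C_ne_zero _
    apply mul_left_cancel₀ hne
    apply Polynomial.funext
    intro t
    simp only [A, B, Polynomial.eval_mul, Polynomial.eval_add, Polynomial.eval_X,
      Polynomial.eval_C, Polynomial.eval_finsetSum, Polynomial.eval_pow, Polynomial.eval_sub,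
      Polynomial.eval_one]
    rw [h t]
    have := (Commute.all m (1 - t)).mul_geom_sum₂ n
    rw [← this]
    ring
  have hA : A.coeff (n - 1 - r) = S r := by
    simp only [A, Polynomial.finsetSum_coeff, Polynomial.coeff_C_mul, Polynomial.coeff_X_pow]
    rw [Finset.sum_eq_single r]
    · simp
    · intro b hb hbr
      rw [Finset.mem_range] at hb
      rw [if_neg (by omega), mul_zero]
    · intro h'
      rw [Finset.mem_range] at h'
      omega
  have hcoef : ∀ N j : ℕ, ((1 - Polynomial.X : Polynomial ℂ) ^ N).coeff j
      = (-1) ^ j * (N.choose j : ℂ) := by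
    intro N j
    have : (1 - Polynomial.X : Polynomial ℂ) ^ N
        = ((1 + Polynomial.X : Polynomial ℂ) ^ N).comp (Polynomial.C (-1) * Polynomial.X) := by
      simp [sub_eq_add_neg]
    rw [this, Polynomial.comp_C_mul_X_coeff, Polynomial.coeff_one_add_X_pow]
    ring
  rw [← hA, hAB]
  simp only [B, Polynomial.finsetSum_coeff, Polynomial.coeff_C_mul, hcoef]
  rw [Finset.mul_sum]
  symm
  apply Finset.sum_subset_zero_on_sdiff
  · intro i hi
    rw [Finset.mem_range] at *
    omega
  · intro i hi
    rw [Finset.mem_sdiff, Finset.mem_range, Finset.mem_range] at hi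
    rw [Nat.choose_eq_zero_of_lt (by omega)]
    simp
  · intro i hi
    rw [Finset.mem_range] at hi
    have : (n - i - 1).choose (r - i) = (n - 1 - i).choose (n - 1 - r) := by
      rw [show n - i - 1 = n - 1 - i by omega]
      rw [← Nat.choose_symm (by omega : n - 1 - r ≤ n - 1 - i)]
      congr 1
      omega
    rw [this]
    ring

/-- Let `V` be homogeneous of degree `k > 2` in `n ≥ 2` variables with
the maximal number `(k-1)ⁿ - 1` of normalized Darboux points, at each of which the
Kovalevskaya matrix `K(d) = V''(d) - E` is nonsingular.  With `Λ(d)` the nontrivial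
Kovalevskaya exponents at `d`, for every `0 ≤ r ≤ n-1`:
`Σ_{d ∈ 𝓓} τ_r(Λ(d)) / τ_{n-1}(Λ(d))
   = (k-2)·(-1)^{r+1-n}·Σ_{i=0}^r C(n-i-1, r-i)·(k-1)ⁱ`. -/
theorem potential_relation_tau_r
    (n k : ℕ) (hn : 2 ≤ n) (hk : 2 < k)
    (V : MvPolynomial (Fin n) ℂ) (hV : V.IsHomogeneous k)
    (D : Finset (Fin n → ℂ))
    (hD : ∀ d, d ∈ D ↔ d ≠ 0 ∧ ∀ i, eval d (pderiv i V) = d i)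
    (hcard : D.card = (k - 1) ^ n - 1)
    (hK : ∀ d ∈ D, ((Matrix.of fun i j => eval d (pderiv i (pderiv j V))) - 1).det ≠ 0)
    (Λ : (Fin n → ℂ) → Fin (n - 1) → ℂ)
    (hΛ : ∀ d ∈ D,
      ((Matrix.of fun i j => eval d (pderiv i (pderiv j V))) - 1).charpoly.roots
        = ((k : ℂ) - 2) ::ₘ Multiset.map (Λ d) Finset.univ.val) :
    ∀ r : ℕ, r ≤ n - 1 →
      ∑ d ∈ D, (Multiset.map (Λ d) Finset.univ.val).esymm r
          / (Multiset.map (Λ d) Finset.univ.val).esymm (n - 1)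
        = ((k : ℂ) - 2) * (-1 : ℂ) ^ ((r : ℤ) + 1 - (n : ℤ)) *
          ∑ i ∈ Finset.range (r + 1), ((n - i - 1).choose (r - i) : ℂ) * ((k : ℂ) - 1) ^ i := by
  obtain ⟨e, rfl⟩ : ∃ e, k = e + 2 := ⟨k - 2, by omega⟩
  have he : 0 < e := by omega
  have hec : (e : ℂ) ≠ 0 := by exact_mod_cast he.ne'
  have hk2 : ((e + 2 : ℕ) : ℂ) - 2 = e := by push_cast; ring
  have hk1 : ((e + 2 : ℕ) : ℂ) - 1 = e + 1 := by push_cast; ring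
  simp only [hk2] at hΛ ⊢
  rw [hk1]
  have hres := residue_sum n e he V hV D hD hcard hK
  have hdet : ∀ d ∈ D, ∀ t : ℂ,
      ((Matrix.of fun i j => eval d (pderiv i (pderiv j V))) + Matrix.scalar (Fin n) (t - 1)).det
        = (t + e) * ∑ r ∈ Finset.range n,
          (Multiset.map (Λ d) Finset.univ.val).esymm r * t ^ (n - 1 - r) := by
    intro d hd t
    rw [← det_add_scalar _ (e : ℂ) hn (Λ d) (hΛ d hd) t]
    congr 1
    rw [map_sub, map_one]
    abel
  have hdet0 : ∀ d ∈ D, ((Matrix.of fun i j => eval d (pderiv i (pderiv j V))) - 1).det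
        = e * (Multiset.map (Λ d) Finset.univ.val).esymm (n - 1) := by
    intro d hd
    have := hdet d hd 0
    rw [zero_sub, map_neg, map_one, ← sub_eq_add_neg, zero_add] at this
    rw [this]
    congr 1
    rw [Finset.sum_eq_single (n - 1)]
    · simp
    · intro b hb hbn
      rw [Finset.mem_range] at hb
      rw [zero_pow (by omega), mul_zero]
    · intro h'
      rw [Finset.mem_range] at h'
      omega
  intro r hr
  have hmain := coeff_compare n hn ((e : ℂ) + 1) (fun r => (e : ℂ)⁻¹ *
    ∑ d ∈ D, (Multiset.map (Λ d) Finset.univ.val).esymm r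
          / (Multiset.map (Λ d) Finset.univ.val).esymm (n - 1)) (by
    intro t
    have h1 := hres (t - 1)
    rw [neg_sub] at h1
    rw [← h1, Finset.mul_sum]
    simp only [Finset.mul_sum, Finset.sum_mul]
    rw [Finset.sum_comm]
    refine Finset.sum_congr rfl fun d hd => ?_
    rw [hdet d hd t, hdet0 d hd, Finset.mul_sum, Finset.sum_div]
    refine Finset.sum_congr rfl fun r _ => ?_
    rw [add_sub_cancel_right]
    rw [div_eq_mul_inv, div_eq_mul_inv, mul_inv]
    ring) r hr
  rw [inv_mul_eq_iff_eq_mul₀ hec] at hmain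
  rw [hmain, ← mul_assoc]
  congr 2
  have : (r : ℤ) + 1 - n = -((n - 1 - r : ℕ) : ℤ) := by omega
  rw [this, zpow_neg, zpow_natCast, ← inv_pow]
  norm_num
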